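/- Let A be a finite-dimensional quasi-hereditary algebra with weight poset (Λ,≤). For every λ ∈ Λ, the Weyl filtration dimension of the costandard module satisfies wfd(∇(λ)) ≤ l(λ), where l(λ) is the maximal length l of a chain μ_0 < μ_1 < ⋯ < μ_{l−1} < μ_l = λ of elements of Λ. -/

import Mathlib

/-!
Interface for a (split) quasi-hereditary algebra `A` over a field `k`,
with weight poset `(Λ, ≤)`, standard modules `Δ λ`, costandard modules `∇ λ`
and simple modules `L λ`.  Ext groups are the right derived functors of the
k-linear Hom functor (`ModuleCat A` has enough injectives), and the good
(resp. Weyl) filtration dimension of a module is defined via the standard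
Ext-characterisation: `gfd M` is the greatest `d` such that
`Ext^d(Δ λ, M) ≠ 0` for some `λ` (resp. `wfd M` the greatest `d` with
`Ext^d(M, ∇ λ) ≠ 0`).
-/

open CategoryTheory CategoryTheory.Limits Opposite

universe u

variable (k : Type u) [Field k] (A : Type u) [Ring A] [Algebra k A]
  [FiniteDimensional k A]
variable (Λ : Type u) [PartialOrder Λ] [Fintype Λ]

/-- `Ext^n_A(X, Y)` as a `k`-module: the `n`-th right derived functor of
`Hom_A(X, -)` applied to `Y`. -/
noncomputable def extA (n : ℕ) (X Y : ModuleCat.{u} A) : ModuleCat.{u} k :=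
  (((linearCoyoneda k (ModuleCat.{u} A)).obj (op X)).rightDerived n).obj Y

/-- `M` has a filtration `0 = M₀ ⊆ M₁ ⊆ ⋯ ⊆ Mₙ = M` whose successive quotients
are isomorphic to members of the family `F`. -/
def ModuleFilteredBy (M : ModuleCat.{u} A) (F : Set (ModuleCat.{u} A)) : Prop :=
  ∃ (n : ℕ) (c : Fin (n + 1) → Submodule A M), Monotone c ∧ c 0 = ⊥ ∧ c (Fin.last n) = ⊤ ∧
    ∀ i : Fin n, ∃ N ∈ F,
      Nonempty ((↥(c i.succ) ⧸ (Submodule.comap (c i.succ).subtype (c i.castSucc))) ≃ₗ[A] N)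

/-- A quasi-hereditary structure on the finite-dimensional algebra `A` with weight
poset `Λ`: the data of standard modules `Δ`, costandard modules `∇` (`nabla`) and
simple modules `L`, subject to the standard axioms (Dlab–Ringel / Donkin A2.2):
`Δ λ` has simple head `L λ`, `∇ λ` has simple socle `L λ`,
`Hom(Δ λ, ∇ μ) = δ_{λμ}·k`, `Ext^n(Δ λ, ∇ μ) = 0` for `n ≥ 1`,
`Hom(Δ λ, Δ μ) ≠ 0 ⟹ λ ≤ μ`, `Ext¹(Δ λ, Δ μ) ≠ 0 ⟹ λ < μ`, and `A` itself
(as a left module) has a filtration by standard modules. -/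
structure QuasiHereditaryData where
  Δ : Λ → ModuleCat.{u} A
  nabla : Λ → ModuleCat.{u} A
  L : Λ → ModuleCat.{u} A
  finΔ : ∀ l, Module.Finite A (Δ l)
  finNabla : ∀ l, Module.Finite A (nabla l)
  finL : ∀ l, Module.Finite A (L l)
  simpleL : ∀ l, Simple (L l)
  simple_complete : ∀ M : ModuleCat.{u} A, Module.Finite A M → Simple M →
    ∃ l, Nonempty (M ≅ L l)
  L_inj : ∀ l m, Nonempty (L l ≅ L m) → l = m
  headΔ : ∀ l, ∃ f : Δ l ⟶ L l, Epi f
  socleNabla : ∀ l, ∃ f : L l ⟶ nabla l, Mono f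
  hom_self : ∀ l, Nonempty ((Δ l ⟶ nabla l) ≃ₗ[k] k)
  hom_ne : ∀ l m, l ≠ m → Subsingleton (Δ l ⟶ nabla m)
  ext_delta_nabla : ∀ n, 0 < n → ∀ l m, IsZero (extA k A n (Δ l) (nabla m))
  hom_delta_order : ∀ l m, ¬ Subsingleton (Δ l ⟶ Δ m) → l ≤ m
  ext_delta_order : ∀ l m, ¬ IsZero (extA k A 1 (Δ l) (Δ m)) → l < m
  A_filtered : ModuleFilteredBy A (ModuleCat.of A A) (Set.range Δ)

variable {k A Λ}

namespace QuasiHereditaryData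

variable (Q : QuasiHereditaryData k A Λ)

/-- The good filtration dimension of `M`: the greatest `d` such that
`Ext^d(Δ λ, M) ≠ 0` for some `λ ∈ Λ`. -/
noncomputable def gfd (M : ModuleCat.{u} A) : ℕ :=
  sSup {d | ∃ l, ¬ IsZero (extA k A d (Q.Δ l) M)}

/-- The Weyl filtration dimension of `M`: the greatest `d` such that
`Ext^d(M, ∇ λ) ≠ 0` for some `λ ∈ Λ`. -/
noncomputable def wfd (M : ModuleCat.{u} A) : ℕ :=
  sSup {d | ∃ l, ¬ IsZero (extA k A d M (Q.nabla l))}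

/-- `wfd(A)`: the supremum of the Weyl filtration dimensions of all
finite-dimensional `A`-modules. -/
noncomputable def wfdAlg : ℕ :=
  sSup {d | ∃ M : ModuleCat.{u} A, Module.Finite A M ∧ Q.wfd M = d}

/-- `gfd(A)`: the supremum of the good filtration dimensions of all
finite-dimensional `A`-modules. -/
noncomputable def gfdAlg : ℕ :=
  sSup {d | ∃ M : ModuleCat.{u} A, Module.Finite A M ∧ Q.gfd M = d}

end QuasiHereditaryData

variable (k A) in
/-- The global dimension of `A`: the supremum of the `d` such that
`Ext^d(N, M) ≠ 0` for some finite-dimensional `A`-modules `N`, `M`. -/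
noncomputable def globAlg : ℕ :=
  sSup {d | ∃ N M : ModuleCat.{u} A, Module.Finite A N ∧ Module.Finite A M ∧
    ¬ IsZero (extA k A d N M)}

/-- the length `l(λ)`: the maximal `l` such that there is a chain
`μ₀ < μ₁ < ⋯ < μ_l = λ` in `Λ`. -/
noncomputable def chainLength (l : Λ) : ℕ :=
  sSup {d | ∃ c : Fin (d + 1) → Λ, StrictMono c ∧ c (Fin.last d) = l}

open CategoryTheory.Abelian

set_option linter.unusedSectionVars false

theorem isZero_extA_succ_iff (n : ℕ) (X Y : ModuleCat.{u} A) :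
    IsZero (extA k A (n + 1) X Y) ↔ Subsingleton (Ext.{u} X Y (n + 1)) := by
  let R := InjectiveResolution.of Y
  let F := (linearCoyoneda k (ModuleCat.{u} A)).obj (op X)
  have h1 : IsZero (extA k A (n + 1) X Y) ↔
      ∀ f : X ⟶ R.cocomplex.X (n + 1), f ≫ R.cocomplex.d (n + 1) (n + 2) = 0 →
        ∃ g : X ⟶ R.cocomplex.X n, g ≫ R.cocomplex.d n (n + 1) = f := by
    rw [show extA k A (n + 1) X Y = (F.rightDerived (n + 1)).obj Y from rfl,
      (R.isoRightDerivedObj F (n + 1)).isZero_iff]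
    change IsZero (((F.mapHomologicalComplex _).obj R.cocomplex).homology (n + 1)) ↔ _
    rw [← HomologicalComplex.exactAt_iff_isZero_homology,
      HomologicalComplex.exactAt_iff' _ n (n + 1) (n + 2) (by simp) (by simp),
      ShortComplex.moduleCat_exact_iff]
    rfl
  rw [h1]
  constructor
  · intro h
    refine subsingleton_of_forall_eq 0 fun α => ?_
    obtain ⟨f, hf, rfl⟩ := R.extMk_surjective α (n + 2) rfl
    exact (R.extMk_eq_zero_iff f _ rfl hf n rfl).2 (h f hf)
  · intro h f hf
    exact (R.extMk_eq_zero_iff f _ rfl hf n rfl).1 (Subsingleton.elim _ _)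

section ShortExact

variable {R : Type u} [Ring R]

/-- `0 → X → F → Y → 0` is a short exact sequence of modules. -/
structure IsSES {X F Y : ModuleCat.{u} R} (i : X →ₗ[R] F) (p : F →ₗ[R] Y) : Prop where
  inj : Function.Injective i
  exact : Function.Exact i p
  surj : Function.Surjective p

theorem subsingleton_ext_zero_iff {X Y : ModuleCat.{u} R} :
    Subsingleton (Ext.{u} X Y 0) ↔ ∀ f : X →ₗ[R] Y, f = 0 := by
  rw [Ext.homEquiv₀.subsingleton_congr, ModuleCat.homEquiv.subsingleton_congr]
  exact ⟨fun h f => Subsingleton.elim _ _, fun h => subsingleton_of_forall_eq 0 h⟩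

namespace IsSES

variable {X F Y : ModuleCat.{u} R} {i : X →ₗ[R] F} {p : F →ₗ[R] Y}

theorem comp_eq_zero (h : IsSES i p) : ModuleCat.ofHom i ≫ ModuleCat.ofHom p = 0 := by
  ext x
  exact h.exact.apply_apply_eq_zero x

theorem shortExact (h : IsSES i p) :
    (ShortComplex.mk (ModuleCat.ofHom i) (ModuleCat.ofHom p) h.comp_eq_zero).ShortExact where
  exact := by
    rw [ShortComplex.moduleCat_exact_iff]
    exact fun x hx => (h.exact x).1 hx
  mono_f := (ModuleCat.mono_iff_injective _).2 h.inj
  epi_g := (ModuleCat.epi_iff_surjective _).2 h.surj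

theorem of_surjective {p : F →ₗ[R] Y} (hp : Function.Surjective p) :
    IsSES (X := ModuleCat.of R (LinearMap.ker p)) (LinearMap.ker p).subtype p where
  inj := Subtype.val_injective
  exact := LinearMap.exact_subtype_ker_map p
  surj := hp

theorem subsingleton_ext_right (h : IsSES i p) {N : ModuleCat.{u} R} {n : ℕ}
    (h₁ : Subsingleton (Ext.{u} X N n)) (h₂ : Subsingleton (Ext.{u} F N (n + 1))) :
    Subsingleton (Ext.{u} Y N (n + 1)) := by
  refine subsingleton_of_forall_eq 0 fun x => ?_
  obtain ⟨y, rfl⟩ := Ext.contravariant_sequence_exact₃ h.shortExact N x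
    (Subsingleton.elim (α := Ext.{u} F N (n + 1)) _ _) (n₀ := n) (by omega)
  rw [show y = 0 from Subsingleton.elim (α := Ext.{u} X N n) _ _, Ext.comp_zero]

theorem subsingleton_ext_left (h : IsSES i p) {N : ModuleCat.{u} R} {n : ℕ}
    (h₁ : Subsingleton (Ext.{u} Y N (n + 1))) (h₂ : Subsingleton (Ext.{u} F N n)) :
    Subsingleton (Ext.{u} X N n) := by
  refine subsingleton_of_forall_eq 0 fun x => ?_
  obtain ⟨y, rfl⟩ := Ext.contravariant_sequence_exact₁ h.shortExact N x (n₁ := n + 1) (by omega)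
    (Subsingleton.elim (α := Ext.{u} Y N (n + 1)) _ _)
  rw [show y = 0 from Subsingleton.elim (α := Ext.{u} F N n) _ _, Ext.comp_zero]

theorem subsingleton_ext_middle (h : IsSES i p) {N : ModuleCat.{u} R} {n : ℕ}
    (h₁ : Subsingleton (Ext.{u} X N n)) (h₂ : Subsingleton (Ext.{u} Y N n)) :
    Subsingleton (Ext.{u} F N n) := by
  refine subsingleton_of_forall_eq 0 fun x => ?_
  obtain ⟨y, rfl⟩ := Ext.contravariant_sequence_exact₂ h.shortExact N x
    (Subsingleton.elim (α := Ext.{u} X N n) _ _)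
  rw [show y = 0 from Subsingleton.elim (α := Ext.{u} Y N n) _ _, Ext.comp_zero]

theorem subsingleton_ext_target (h : IsSES i p) {N : ModuleCat.{u} R} {n : ℕ}
    (h₁ : Subsingleton (Ext.{u} N X n)) (h₂ : Subsingleton (Ext.{u} N Y n)) :
    Subsingleton (Ext.{u} N F n) := by
  refine subsingleton_of_forall_eq 0 fun x => ?_
  obtain ⟨y, rfl⟩ := Ext.covariant_sequence_exact₂ N h.shortExact x
    (Subsingleton.elim (α := Ext.{u} N Y n) _ _)
  rw [show y = 0 from Subsingleton.elim (α := Ext.{u} N X n) _ _, Ext.zero_comp]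

theorem exists_extend (h : IsSES i p) {N : ModuleCat.{u} R} (h₁ : Subsingleton (Ext.{u} Y N 1))
    (f : X →ₗ[R] N) : ∃ g : F →ₗ[R] N, g ∘ₗ i = f := by
  obtain ⟨y, hy⟩ := Ext.contravariant_sequence_exact₁ h.shortExact N
    (Ext.mk₀ (ModuleCat.ofHom f)) (n₁ := 1) (by omega)
    (Subsingleton.elim (α := Ext.{u} Y N 1) _ _)
  obtain ⟨g, rfl⟩ := (Ext.mk₀_bijective _ _).2 y
  rw [Ext.mk₀_comp_mk₀] at hy
  have := (Ext.mk₀_bijective _ _).1 hy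
  exact ⟨g.hom, congrArg ModuleCat.Hom.hom this⟩

theorem exists_lift (h : IsSES i p) {N : ModuleCat.{u} R} (h₁ : Subsingleton (Ext.{u} N X 1))
    (f : N →ₗ[R] Y) : ∃ g : N →ₗ[R] F, p ∘ₗ g = f := by
  obtain ⟨y, hy⟩ := Ext.covariant_sequence_exact₃ N h.shortExact
    (Ext.mk₀ (ModuleCat.ofHom f)) (n₁ := 1) (by omega)
    (Subsingleton.elim (α := Ext.{u} N X 1) _ _)
  obtain ⟨g, rfl⟩ := (Ext.mk₀_bijective _ _).2 y
  rw [Ext.mk₀_comp_mk₀] at hy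
  have := (Ext.mk₀_bijective _ _).1 hy
  exact ⟨g.hom, congrArg ModuleCat.Hom.hom this⟩

theorem exists_factor_left (h : IsSES i p) {N : ModuleCat.{u} R} (f : N →ₗ[R] F)
    (hf : p ∘ₗ f = 0) : ∃ g : N →ₗ[R] X, i ∘ₗ g = f := by
  let e := LinearEquiv.ofInjective i h.inj
  refine ⟨e.symm.toLinearMap ∘ₗ f.codRestrict (LinearMap.range i) fun x =>
    (h.exact (f x)).1 (LinearMap.congr_fun hf x), ?_⟩
  ext x
  have := congrArg Subtype.val (e.apply_symm_apply (f.codRestrict (LinearMap.range i) (fun x =>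
    (h.exact (f x)).1 (LinearMap.congr_fun hf x)) x))
  exact this

theorem exists_factor_right (h : IsSES i p) {N : ModuleCat.{u} R} (f : F →ₗ[R] N)
    (hf : f ∘ₗ i = 0) : ∃ g : Y →ₗ[R] N, g ∘ₗ p = f := by
  let e := p.quotKerEquivOfSurjective h.surj
  have hk : LinearMap.ker p ≤ LinearMap.ker f := by
    intro x hx
    obtain ⟨y, rfl⟩ := (h.exact x).1 hx
    exact LinearMap.congr_fun hf y
  refine ⟨(LinearMap.ker p).liftQ f hk ∘ₗ e.symm.toLinearMap, ?_⟩
  ext x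
  have : e.symm (p x) = (LinearMap.ker p).mkQ x := e.symm_apply_eq.2 rfl
  simp [this]

end IsSES

end ShortExact

namespace QuasiHereditaryData

variable (Q : QuasiHereditaryData k A Λ)

theorem hom_Δ_nabla_eq_zero {l m : Λ} (h : l ≠ m) (f : Q.Δ l →ₗ[A] Q.nabla m) : f = 0 := by
  have := Q.hom_ne l m h
  exact congrArg ModuleCat.Hom.hom (Subsingleton.elim (ModuleCat.ofHom f) 0)

theorem hom_Δ_Δ_eq_zero {l m : Λ} (h : ¬ l ≤ m) (f : Q.Δ l →ₗ[A] Q.Δ m) : f = 0 := by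
  have := not_not.1 (mt (Q.hom_delta_order l m) h)
  exact congrArg ModuleCat.Hom.hom (Subsingleton.elim (ModuleCat.ofHom f) 0)

theorem subsingleton_ext_Δ_nabla (n : ℕ) (l m : Λ) :
    Subsingleton (Ext.{u} (Q.Δ l) (Q.nabla m) (n + 1)) :=
  (isZero_extA_succ_iff n _ _).1 (Q.ext_delta_nabla (n + 1) n.succ_pos l m)

theorem subsingleton_ext_Δ_Δ {l m : Λ} (h : ¬ l < m) :
    Subsingleton (Ext.{u} (Q.Δ l) (Q.Δ m) 1) :=
  (isZero_extA_succ_iff 0 _ _).1 (not_not.1 (mt (Q.ext_delta_order l m) h))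

theorem exists_hom_Δ_nabla_ne_zero (l : Λ) : ∃ f : Q.Δ l →ₗ[A] Q.nabla l, f ≠ 0 := by
  obtain ⟨e⟩ := Q.hom_self l
  refine ⟨(e.symm 1).hom, fun h => one_ne_zero (α := k) (e.symm.injective ?_)⟩
  rw [map_zero]
  exact ModuleCat.hom_ext h

/-- `Hom(Δ l, ∇ l)` is one-dimensional. -/
theorem comp_eq_zero_of_hom_Δ_nabla {l : Λ} {q : Q.Δ l →ₗ[A] Q.nabla l} (hq : q ≠ 0)
    (p : Q.Δ l →ₗ[A] Q.nabla l) {M : ModuleCat.{u} A} {g : M →ₗ[A] Q.Δ l} (hg : q ∘ₗ g = 0) :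
    p ∘ₗ g = 0 := by
  obtain ⟨e⟩ := Q.hom_self l
  have hq' : e (ModuleCat.ofHom q) ≠ 0 := fun h =>
    hq (congrArg ModuleCat.Hom.hom ((map_eq_zero_iff e e.injective).1 h))
  have hp : ModuleCat.ofHom p =
      (e (ModuleCat.ofHom p) / e (ModuleCat.ofHom q)) • ModuleCat.ofHom q := by
    apply e.injective
    rw [map_smul, smul_eq_mul, div_mul_cancel₀ _ hq']
  have h0 : ModuleCat.ofHom g ≫ ModuleCat.ofHom q = 0 := ModuleCat.hom_ext hg
  have : ModuleCat.ofHom g ≫ ModuleCat.ofHom p = 0 := by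
    rw [hp, Linear.comp_smul, h0, smul_zero]
  exact congrArg ModuleCat.Hom.hom this

/-- There are no nonzero maps `Δ ν → M` with `ν ∉ Γ`. -/
def SupportedOn (Γ : Set Λ) (M : ModuleCat.{u} A) : Prop :=
  ∀ ν ∉ Γ, ∀ f : Q.Δ ν →ₗ[A] M, f = 0

/-- `M` has a filtration with `n` successive quotients, each isomorphic to `Δ ν` for some
`ν ∈ Γ`. -/
inductive WeylFiltered (Γ : Set Λ) : ℕ → ModuleCat.{u} A → Prop
  | zero (M : ModuleCat.{u} A) (h : Subsingleton M) : WeylFiltered Γ 0 M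
  | step {n : ℕ} {X F : ModuleCat.{u} A} {ν : Λ} (hν : ν ∈ Γ) (i : X →ₗ[A] F)
      (p : F →ₗ[A] Q.Δ ν) (h : IsSES i p) (hX : WeylFiltered Γ n X) : WeylFiltered Γ (n + 1) F

variable {Q} {Γ : Set Λ}

namespace SupportedOn

theorem of_injective {M N : ModuleCat.{u} A} (hM : Q.SupportedOn Γ M) (i : N →ₗ[A] M)
    (hi : Function.Injective i) : Q.SupportedOn Γ N := by
  intro ν hν f
  ext x
  apply hi
  rw [LinearMap.zero_apply, map_zero]
  exact LinearMap.congr_fun (hM ν hν (i ∘ₗ f)) x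

theorem submodule {M : ModuleCat.{u} A} (hM : Q.SupportedOn Γ M) (N : Submodule A M) :
    Q.SupportedOn Γ (ModuleCat.of A N) :=
  hM.of_injective N.subtype Subtype.val_injective

theorem prod {M N : ModuleCat.{u} A} (hM : Q.SupportedOn Γ M) (hN : Q.SupportedOn Γ N) :
    Q.SupportedOn Γ (ModuleCat.of A (M × N)) := by
  intro ν hν f
  ext x
  · exact LinearMap.congr_fun (hM ν hν (LinearMap.fst A M N ∘ₗ f)) x
  · exact LinearMap.congr_fun (hN ν hν (LinearMap.snd A M N ∘ₗ f)) x

theorem of_isSES {X F Y : ModuleCat.{u} A} {i : X →ₗ[A] F} {p : F →ₗ[A] Y} (h : IsSES i p)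
    (hX : Q.SupportedOn Γ X) (hY : Q.SupportedOn Γ Y) : Q.SupportedOn Γ F := by
  intro ν hν f
  obtain ⟨g, rfl⟩ := h.exists_factor_left f (hY ν hν _)
  rw [hX ν hν g, LinearMap.comp_zero]

theorem Δ (hΓ : IsLowerSet Γ) {ν : Λ} (hν : ν ∈ Γ) : Q.SupportedOn Γ (Q.Δ ν) :=
  fun _ hμ f => Q.hom_Δ_Δ_eq_zero (fun h => hμ (hΓ h hν)) f

theorem nabla {ν : Λ} (hν : ν ∈ Γ) : Q.SupportedOn Γ (Q.nabla ν) :=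
  fun μ hμ f => Q.hom_Δ_nabla_eq_zero (fun h : μ = ν => hμ (by rw [h]; exact hν)) f

end SupportedOn

namespace WeylFiltered

variable {n m : ℕ} {F : ModuleCat.{u} A}

theorem of_equiv {M N : ModuleCat.{u} A} (hM : Q.WeylFiltered Γ n M) (e : M ≃ₗ[A] N) :
    Q.WeylFiltered Γ n N := by
  cases hM with
  | zero _ h => exact zero _ e.symm.toEquiv.subsingleton
  | step hν i p h hX =>
    refine step hν (e.toLinearMap ∘ₗ i) (p ∘ₗ e.symm.toLinearMap) ⟨?_, ?_, ?_⟩ hX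
    · exact e.injective.comp h.inj
    · intro y
      refine (h.exact (e.symm y)).trans ⟨?_, ?_⟩
      · rintro ⟨x, hx⟩
        exact ⟨x, by simp [hx]⟩
      · rintro ⟨x, rfl⟩
        exact ⟨x, by simp⟩
    · exact h.surj.comp e.symm.surjective

theorem append {X Y : ModuleCat.{u} A} (hX : Q.WeylFiltered Γ n X) (hY : Q.WeylFiltered Γ m Y) :
    ∀ {F : ModuleCat.{u} A} {i : X →ₗ[A] F} {p : F →ₗ[A] Y}, IsSES i p →
      Q.WeylFiltered Γ (n + m) F := by
  induction hY with
  | zero Y hY =>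
    intro F i p h
    refine hX.of_equiv (LinearEquiv.ofBijective i ⟨h.inj, fun y => ?_⟩)
    exact (h.exact y).1 (Subsingleton.elim _ _)
  | @step m Y' Y ν hν j q hj _ ih =>
    intro F i p h
    let F' : Submodule A (F × Y') :=
      LinearMap.eqLocus (p ∘ₗ LinearMap.fst A F Y') (j ∘ₗ LinearMap.snd A F Y')
    have hF' : Q.WeylFiltered Γ (n + m) (ModuleCat.of A F') := by
      refine ih (i := (i.prod 0).codRestrict F' fun x => ?_)
        (p := LinearMap.snd A F Y' ∘ₗ F'.subtype) ⟨?_, ?_, ?_⟩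
      · change p (i x) = j 0
        rw [h.exact.apply_apply_eq_zero, map_zero]
      · intro x y hxy
        exact h.inj (congrArg (fun z : F' => z.1.1) hxy)
      · rintro ⟨⟨y, z⟩, hyz⟩
        change p y = j z at hyz
        constructor
        · rintro (rfl : z = 0)
          rw [map_zero] at hyz
          obtain ⟨x, rfl⟩ := (h.exact y).1 hyz
          exact ⟨x, rfl⟩
        · rintro ⟨x, hx⟩
          exact (congrArg (fun z : F' => z.1.2) hx).symm
      · intro z
        obtain ⟨y, hy⟩ := h.surj (j z)
        exact ⟨⟨(y, z), hy⟩, rfl⟩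
    refine step hν (X := ModuleCat.of A F') (LinearMap.fst A F Y' ∘ₗ F'.subtype) (q ∘ₗ p)
      ⟨?_, ?_, ?_⟩ hF'
    · rintro ⟨⟨y, z⟩, hyz⟩ ⟨⟨y', z'⟩, hyz'⟩ (rfl : y = y')
      have : z = z' := hj.inj (Eq.trans (Eq.symm hyz) hyz')
      subst this
      rfl
    · intro y
      refine (hj.exact (p y)).trans ⟨?_, ?_⟩
      · rintro ⟨z, hz⟩
        exact ⟨⟨(y, z), hz.symm⟩, rfl⟩
      · rintro ⟨⟨⟨y', z⟩, hyz⟩, rfl⟩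
        exact ⟨z, Eq.symm hyz⟩
    · exact hj.surj.comp h.surj

theorem supportedOn (hΓ : IsLowerSet Γ) (hF : Q.WeylFiltered Γ n F) : Q.SupportedOn Γ F := by
  induction hF with
  | zero M h => exact fun _ _ f => LinearMap.ext fun x => Subsingleton.elim _ _
  | step hν i p h _ ih => exact ih.of_isSES h (.Δ hΓ hν)

theorem subsingleton_ext_nabla (hF : Q.WeylFiltered Γ n F) (i : ℕ) (μ : Λ) :
    Subsingleton (Ext.{u} F (Q.nabla μ) (i + 1)) := by
  induction hF with
  | zero M h =>
    have : IsZero M := ModuleCat.isZero_of_subsingleton M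
    refine subsingleton_of_forall_eq 0 fun x => ?_
    rw [← Ext.mk₀_id_comp x, this.eq_zero_of_src (𝟙 M), Ext.mk₀_zero, Ext.zero_comp]
  | step hν _ _ h _ ih => exact h.subsingleton_ext_middle ih (Q.subsingleton_ext_Δ_nabla _ _ _)

theorem subsingleton_ext_Δ (hF : Q.WeylFiltered Γ n F) {l : Λ} (hl : ∀ ν ∈ Γ, ¬ l < ν) :
    Subsingleton (Ext.{u} (Q.Δ l) F 1) := by
  induction hF with
  | zero M h =>
    have : IsZero M := ModuleCat.isZero_of_subsingleton M
    refine subsingleton_of_forall_eq 0 fun x => ?_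
    rw [← Ext.comp_mk₀_id x, this.eq_zero_of_src (𝟙 M), Ext.mk₀_zero, Ext.comp_zero]
  | step hν _ _ h _ ih => exact h.subsingleton_ext_target ih (Q.subsingleton_ext_Δ_Δ (hl _ hν))

theorem finite (hF : Q.WeylFiltered Γ n F) : Module.Finite A F := by
  have : IsNoetherianRing A := IsNoetherianRing.of_finite k A
  suffices IsNoetherian A F from inferInstance
  induction hF with
  | zero M h => infer_instance
  | @step _ _ _ ν hν i p h _ ih =>
    have := Q.finΔ ν
    exact isNoetherian_of_range_eq_ker i p (LinearMap.exact_iff.1 h.exact).symm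

end WeylFiltered

variable (Q)

theorem exists_weylFiltered_self : ∃ n, Q.WeylFiltered Set.univ n (ModuleCat.of A A) := by
  obtain ⟨n, c, hc, h0, hn, hq⟩ := Q.A_filtered
  have key : ∀ i : Fin (n + 1), Q.WeylFiltered Set.univ i (ModuleCat.of A (c i)) := by
    intro i
    induction i using Fin.induction with
    | zero =>
      refine .zero _ ?_
      change Subsingleton (c 0)
      rw [h0]
      infer_instance
    | succ i ih =>
      obtain ⟨_, ⟨ν, rfl⟩, ⟨e⟩⟩ := hq i
      have hle : c i.castSucc ≤ c i.succ := hc i.castSucc_le_succ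
      have := WeylFiltered.step (F := ModuleCat.of A (c i.succ)) (Set.mem_univ ν)
        (Submodule.inclusion hle) (e.toLinearMap ∘ₗ Submodule.mkQ _) ⟨?_, ?_, ?_⟩ ih
      · simpa using this
      · exact Submodule.inclusion_injective hle
      · intro x
        simp only [LinearMap.comp_apply, LinearEquiv.coe_coe, map_eq_zero_iff e e.injective,
          Submodule.mkQ_apply, Submodule.Quotient.mk_eq_zero]
        exact ⟨fun hx => ⟨⟨x.1, hx⟩, rfl⟩, fun ⟨y, hy⟩ => hy ▸ y.2⟩
      · exact e.surjective.comp (Submodule.mkQ_surjective _)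
  refine ⟨_, (key (Fin.last n)).of_equiv (N := ModuleCat.of A A) ?_⟩
  exact (LinearEquiv.ofEq _ _ hn).trans Submodule.topEquiv

variable {Q} {Γ : Set Λ}

/-- Every Weyl filtered module has a universal map to a module filtered by `Δ ν`, `ν ∈ Γ`. -/
theorem WeylFiltered.exists_truncation (hΓ : IsLowerSet Γ) {n : ℕ} {F : ModuleCat.{u} A}
    (hF : Q.WeylFiltered Set.univ n F) :
    ∃ (m : ℕ) (B : ModuleCat.{u} A) (f : F →ₗ[A] B), Q.WeylFiltered Γ m B ∧
      ∀ M : ModuleCat.{u} A, Q.SupportedOn Γ M → ∀ g : F →ₗ[A] M, ∃ h : B →ₗ[A] M, h ∘ₗ f = g := by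
  induction hF with
  | zero F h =>
    exact ⟨0, F, LinearMap.id, .zero F h, fun M _ g => ⟨g, rfl⟩⟩
  | @step n X F ν _ i p h _ ih =>
    obtain ⟨m, B, f, hB, hf⟩ := ih
    by_cases hν : ν ∈ Γ
    · let N : Submodule A (B × F) := LinearMap.range (f.prod (-i))
      let i' : B →ₗ[A] (B × F) ⧸ N := N.mkQ ∘ₗ LinearMap.inl A B F
      let p' : (B × F) ⧸ N →ₗ[A] Q.Δ ν := N.liftQ (p ∘ₗ LinearMap.snd A B F) (by
        rintro _ ⟨x, rfl⟩
        simp [h.exact.apply_apply_eq_zero])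
      refine ⟨m + 1, ModuleCat.of A ((B × F) ⧸ N), N.mkQ ∘ₗ LinearMap.inr A B F,
        .step hν i' p' ⟨?_, ?_, ?_⟩ hB, ?_⟩
      · rw [← LinearMap.ker_eq_bot, LinearMap.ker_eq_bot']
        intro b hb
        obtain ⟨x, hx⟩ := (Submodule.Quotient.mk_eq_zero N).1 hb
        have h1 : f x = b := congrArg Prod.fst hx
        have h2 : -i x = 0 := congrArg Prod.snd hx
        have h3 : x = 0 := h.inj (by rw [map_zero, ← neg_eq_zero, h2])
        rw [← h1, h3, map_zero]
      · intro z
        obtain ⟨⟨b, y⟩, rfl⟩ := N.mkQ_surjective z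
        constructor
        · intro hy
          obtain ⟨x, rfl⟩ := (h.exact y).1 hy
          refine ⟨b + f x, (Submodule.Quotient.eq N).2 ⟨x, ?_⟩⟩
          simp
        · rintro ⟨b', hb'⟩
          rw [← hb']
          exact map_zero p
      · intro z
        obtain ⟨y, rfl⟩ := h.surj z
        exact ⟨N.mkQ (0, y), rfl⟩
      · intro M hM g
        obtain ⟨t, ht⟩ := hf M hM (g ∘ₗ i)
        refine ⟨N.liftQ (t.coprod g) ?_, ?_⟩
        · rintro _ ⟨x, rfl⟩
          have h1 : t (f x) = g (i x) := LinearMap.congr_fun ht x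
          simp [h1]
        · ext y
          simp
    · have hext := hB.subsingleton_ext_Δ (l := ν) fun μ hμ hlt => hν (hΓ hlt.le hμ)
      obtain ⟨f', hf'⟩ := h.exists_extend hext f
      refine ⟨m, B, f', hB, fun M hM g => ?_⟩
      obtain ⟨t, ht⟩ := hf M hM (g ∘ₗ i)
      obtain ⟨q, hq⟩ := h.exists_factor_right (g - t ∘ₗ f') (by
        rw [LinearMap.sub_comp, LinearMap.comp_assoc, hf', ht, sub_self])
      rw [hM ν hν q, LinearMap.zero_comp] at hq
      exact ⟨t, (sub_eq_zero.1 hq.symm).symm⟩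

/-- Finitely generated modules supported on `Γ` are quotients of modules filtered by `Δ ν`,
`ν ∈ Γ`. -/
theorem SupportedOn.exists_cover (hΓ : IsLowerSet Γ) {M : ModuleCat.{u} A}
    (hM : Q.SupportedOn Γ M) [Module.Finite A M] :
    ∃ (n : ℕ) (F : ModuleCat.{u} A) (f : F →ₗ[A] M),
      Q.WeylFiltered Γ n F ∧ Function.Surjective f := by
  suffices h : ∀ N : Submodule A M, N.FG → ∃ (n : ℕ) (F : ModuleCat.{u} A) (f : F →ₗ[A] M),
      Q.WeylFiltered Γ n F ∧ N ≤ LinearMap.range f by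
    obtain ⟨n, F, f, hF, hf⟩ := h ⊤ Module.Finite.fg_top
    exact ⟨n, F, f, hF, LinearMap.range_eq_top.1 (top_le_iff.1 hf)⟩
  intro N hN
  induction N, hN using Submodule.fg_induction with
  | singleton x =>
    obtain ⟨n, hn⟩ := Q.exists_weylFiltered_self
    obtain ⟨m, B, f, hB, hf⟩ := hn.exists_truncation hΓ
    obtain ⟨t, ht⟩ := hf M hM (LinearMap.toSpanSingleton A M x)
    refine ⟨m, B, t, hB, ?_⟩
    rw [Submodule.span_singleton_le_iff_mem]
    refine ⟨f (1 : A), ?_⟩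
    have := LinearMap.congr_fun ht (1 : A)
    simpa using this
  | sup N₁ N₂ _ _ h₁ h₂ =>
    obtain ⟨n₁, F₁, f₁, hF₁, hf₁⟩ := h₁
    obtain ⟨n₂, F₂, f₂, hF₂, hf₂⟩ := h₂
    refine ⟨n₁ + n₂, ModuleCat.of A (F₁ × F₂), f₁.coprod f₂,
      hF₁.append hF₂ (i := LinearMap.inl A F₁ F₂) (p := LinearMap.snd A F₁ F₂)
        ⟨LinearMap.inl_injective, ?_, LinearMap.snd_surjective⟩, ?_⟩
    · exact Function.Exact.inl_snd
    · rw [LinearMap.range_coprod]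
      exact sup_le_sup hf₁ hf₂

/-- A Weyl filtered module whose nonzero maps to `T` are detected on `Δ l`, `l` maximal. -/
theorem WeylFiltered.exists_comp_ne_zero {n : ℕ} {F : ModuleCat.{u} A}
    (hF : Q.WeylFiltered Γ n F) {l : Λ} (hl : ∀ ν ∈ Γ, ¬ l < ν) {T : ModuleCat.{u} A}
    (hT : ∀ ν ∈ Γ, ν ≠ l → ∀ f : Q.Δ ν →ₗ[A] T, f = 0) (f : F →ₗ[A] T) (hf : f ≠ 0) :
    ∃ α : Q.Δ l →ₗ[A] F, f ∘ₗ α ≠ 0 := by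
  induction hF with
  | zero M h => exact (hf (LinearMap.ext fun x => by simp [Subsingleton.elim x 0])).elim
  | @step n X F ν hν i p h hX ih =>
    by_cases hfi : f ∘ₗ i = 0
    · obtain ⟨g, rfl⟩ := h.exists_factor_right f hfi
      by_cases hνl : ν = l
      · subst hνl
        obtain ⟨s, hs⟩ := h.exists_lift (hX.subsingleton_ext_Δ hl) LinearMap.id
        refine ⟨s, fun h0 => hf ?_⟩
        rw [LinearMap.comp_assoc, hs, LinearMap.comp_id] at h0
        rw [h0, LinearMap.zero_comp]
      · rw [hT ν hν hνl g, LinearMap.zero_comp] at hf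
        exact (hf rfl).elim
    · obtain ⟨α, hα⟩ := ih (f ∘ₗ i) hfi
      exact ⟨i ∘ₗ α, hα⟩

variable (Q) in
theorem exists_hom_nabla_ne_zero {C : ModuleCat.{u} A} [Module.Finite A C] [Nontrivial C] :
    ∃ (ν : Λ) (f : C →ₗ[A] Q.nabla ν), f ≠ 0 := by
  obtain ⟨N, hN⟩ := IsCoatomic.exists_coatom (Submodule A C)
  have hs : IsSimpleModule A (C ⧸ N) := isSimpleModule_iff_isCoatom.2 hN
  have : Simple (ModuleCat.of A (C ⧸ N)) := (simple_iff_isSimpleModule).2 hs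
  obtain ⟨ν, ⟨e⟩⟩ := Q.simple_complete (ModuleCat.of A (C ⧸ N))
    (inferInstanceAs (Module.Finite A (C ⧸ N))) this
  obtain ⟨j, hj⟩ := Q.socleNabla ν
  have hj' := (ModuleCat.mono_iff_injective _).1 hj
  refine ⟨ν, j.hom ∘ₗ e.toLinearEquiv.toLinearMap ∘ₗ N.mkQ, fun h => hN.1 ?_⟩
  rw [eq_top_iff]
  intro x _
  have h1 : j.hom (e.toLinearEquiv (N.mkQ x)) = 0 := LinearMap.congr_fun h x
  rw [map_eq_zero_iff _ hj', map_eq_zero_iff _ e.toLinearEquiv.injective] at h1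
  exact (Submodule.Quotient.mk_eq_zero N).1 h1

/-- Maps to `Δ l` are surjective if they remain nonzero in `∇ l`. -/
theorem surjective_of_comp_ne_zero {l : Λ} {M : ModuleCat.{u} A} (g : M →ₗ[A] Q.Δ l)
    (p : Q.Δ l →ₗ[A] Q.nabla l) (h : p ∘ₗ g ≠ 0) : Function.Surjective g := by
  by_contra hg
  have := Q.finΔ l
  let C := ModuleCat.of A (Q.Δ l ⧸ LinearMap.range g)
  have : Module.Finite A C := inferInstanceAs (Module.Finite A (Q.Δ l ⧸ LinearMap.range g))
  have : Nontrivial C := Submodule.Quotient.nontrivial_iff.2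
    (mt LinearMap.range_eq_top.1 hg)
  obtain ⟨ν, f, hf⟩ := Q.exists_hom_nabla_ne_zero (C := C)
  have hf' : f ∘ₗ (LinearMap.range g).mkQ ≠ 0 := by
    intro h0
    apply hf
    ext x
    exact LinearMap.congr_fun h0 x
  have hν : l = ν := by
    by_contra hν
    exact hf' (Q.hom_Δ_nabla_eq_zero hν _)
  subst hν
  refine h (Q.comp_eq_zero_of_hom_Δ_nabla hf' p ?_)
  ext x
  have : (LinearMap.range g).mkQ (g x) = 0 := (Submodule.Quotient.mk_eq_zero _).2 ⟨x, rfl⟩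
  change f ((LinearMap.range g).mkQ (g x)) = 0
  rw [this, map_zero]

theorem bijective_of_comp_ne_zero {l : Λ} (g : Q.Δ l →ₗ[A] Q.Δ l)
    (p : Q.Δ l →ₗ[A] Q.nabla l) (h : p ∘ₗ g ≠ 0) : Function.Bijective g := by
  have hs := surjective_of_comp_ne_zero g p h
  have : IsNoetherianRing A := IsNoetherianRing.of_finite k A
  have := Q.finΔ l
  exact ⟨IsNoetherian.injective_of_surjective_endomorphism g hs, hs⟩

/-- `Δ l` is projective among modules supported on `Γ` if `l` is maximal. -/
theorem SupportedOn.exists_section (hΓ : IsLowerSet Γ) {M : ModuleCat.{u} A}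
    (hM : Q.SupportedOn Γ M) [Module.Finite A M] {l : Λ} (hl : ∀ ν ∈ Γ, ¬ l < ν)
    (p : M →ₗ[A] Q.Δ l) (hp : Function.Surjective p) :
    ∃ s : Q.Δ l →ₗ[A] M, p ∘ₗ s = LinearMap.id := by
  obtain ⟨n, F, f, hF, hf⟩ := hM.exists_cover hΓ
  obtain ⟨q, hq⟩ := Q.exists_hom_Δ_nabla_ne_zero l
  obtain ⟨α, hα⟩ := hF.exists_comp_ne_zero hl
    (fun ν _ hν g => Q.hom_Δ_nabla_eq_zero hν g) (q ∘ₗ p ∘ₗ f) (by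
      intro h
      apply hq
      ext x
      obtain ⟨y, rfl⟩ := hp x
      obtain ⟨z, rfl⟩ := hf y
      exact LinearMap.congr_fun h z)
  let e := LinearEquiv.ofBijective (p ∘ₗ f ∘ₗ α) (bijective_of_comp_ne_zero _ q hα)
  refine ⟨f ∘ₗ α ∘ₗ e.symm.toLinearMap, ?_⟩
  ext x
  exact e.apply_symm_apply x

theorem SupportedOn.exists_lift (hΓ : IsLowerSet Γ) {X Y : ModuleCat.{u} A}
    (hX : Q.SupportedOn Γ X) [Module.Finite A X] {l : Λ} (hlΓ : l ∈ Γ) (hl : ∀ ν ∈ Γ, ¬ l < ν)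
    (p : X →ₗ[A] Y) (hp : Function.Surjective p) (f : Q.Δ l →ₗ[A] Y) :
    ∃ g : Q.Δ l →ₗ[A] X, p ∘ₗ g = f := by
  have : IsNoetherianRing A := IsNoetherianRing.of_finite k A
  have := Q.finΔ l
  let E : Submodule A (X × Q.Δ l) :=
    LinearMap.eqLocus (p ∘ₗ LinearMap.fst A X _) (f ∘ₗ LinearMap.snd A X (Q.Δ l))
  have : Module.Finite A (ModuleCat.of A E) := inferInstanceAs (Module.Finite A E)
  obtain ⟨s, hs⟩ := ((hX.prod (.Δ hΓ hlΓ)).submodule E).exists_section hΓ hl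
    (LinearMap.snd A X _ ∘ₗ E.subtype) (by
      intro y
      obtain ⟨x, hx⟩ := hp (f y)
      exact ⟨⟨(x, y), hx⟩, rfl⟩)
  refine ⟨LinearMap.fst A X _ ∘ₗ E.subtype ∘ₗ s, ?_⟩
  ext y
  refine (s y).2.trans ?_
  exact congrArg f (LinearMap.congr_fun hs y)

variable (Q) in
theorem subsingleton_of_hom_Δ_eq_zero (M : ModuleCat.{u} A) [Module.Finite A M]
    (hM : ∀ ν, ∀ f : Q.Δ ν →ₗ[A] M, f = 0) : Subsingleton M := by
  have hM' : Q.SupportedOn ∅ M := fun ν _ => hM ν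
  obtain ⟨n, F, f, hF, hf⟩ := hM'.exists_cover isLowerSet_empty
  cases hF with
  | zero _ h => exact hf.subsingleton
  | step hν => exact hν.elim

theorem _root_.IsSES.exists_quotient {X F Y N Y' : ModuleCat.{u} A} {i : X →ₗ[A] F}
    {p : F →ₗ[A] Y} (h : IsSES i p) {φ : N →ₗ[A] X} {π : X →ₗ[A] Y'} (h' : IsSES φ π) :
    ∃ (Z : ModuleCat.{u} A) (ρ : F →ₗ[A] Z) (j : Y' →ₗ[A] Z) (q : Z →ₗ[A] Y),
      IsSES (i ∘ₗ φ) ρ ∧ IsSES j q := by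
  let R := LinearMap.range (i ∘ₗ φ)
  obtain ⟨j, hj⟩ := h'.exists_factor_right (N := ModuleCat.of A (F ⧸ R)) (R.mkQ ∘ₗ i) (by
    ext z
    exact (Submodule.Quotient.mk_eq_zero R).2 ⟨z, rfl⟩)
  have hj' : ∀ x, j (π x) = R.mkQ (i x) := LinearMap.congr_fun hj
  refine ⟨ModuleCat.of A (F ⧸ R), R.mkQ, j, R.liftQ p ?_,
    ⟨h.inj.comp h'.inj, LinearMap.exact_iff.2 R.ker_mkQ, R.mkQ_surjective⟩, ?_, ?_, ?_⟩
  · rintro _ ⟨x, rfl⟩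
    exact h.exact.apply_apply_eq_zero _
  · rw [← LinearMap.ker_eq_bot, LinearMap.ker_eq_bot']
    intro y hy
    obtain ⟨x, rfl⟩ := h'.surj y
    rw [hj'] at hy
    obtain ⟨z, hz⟩ := (Submodule.Quotient.mk_eq_zero R).1 hy
    rw [← h.inj hz, h'.exact.apply_apply_eq_zero]
  · intro z
    obtain ⟨y, rfl⟩ := R.mkQ_surjective z
    constructor
    · intro hy
      obtain ⟨x, rfl⟩ := (h.exact y).1 hy
      exact ⟨π x, hj' x⟩
    · rintro ⟨y', hy'⟩
      obtain ⟨x, rfl⟩ := h'.surj y'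
      rw [hj'] at hy'
      rw [← hy']
      exact h.exact.apply_apply_eq_zero x
  · intro y
    obtain ⟨x, rfl⟩ := h.surj y
    exact ⟨R.mkQ x, rfl⟩

theorem WeylFiltered.Δ {ν : Λ} (hν : ν ∈ Γ) : Q.WeylFiltered Γ 1 (Q.Δ ν) :=
  .step (X := ModuleCat.of A PUnit) hν 0 LinearMap.id
    ⟨fun _ _ _ => rfl, fun _ => ⟨fun h => ⟨0, h.symm⟩, fun ⟨_, h⟩ => h.symm⟩,
      Function.surjective_id⟩ (.zero _ inferInstance)

/-- A copy of `Δ l` in a Weyl filtered module which is detected by `∇ l` can be split off. -/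
theorem WeylFiltered.exists_quotient {n : ℕ} {F : ModuleCat.{u} A} (hF : Q.WeylFiltered Γ n F)
    {l : Λ} (hl : ∀ ν ∈ Γ, ¬ l < ν) (φ : Q.Δ l →ₗ[A] F) (ψ : F →ₗ[A] Q.nabla l)
    (h : ψ ∘ₗ φ ≠ 0) :
    ∃ (m : ℕ) (Y : ModuleCat.{u} A) (π : F →ₗ[A] Y),
      m < n ∧ Q.WeylFiltered Γ m Y ∧ IsSES φ π := by
  induction hF with
  | zero M hM => exact (h (LinearMap.ext fun x => by simp [Subsingleton.elim (φ x) 0])).elim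
  | @step n X F ν hν i p hs hX ih =>
    by_cases hνl : ν = l
    · subst hνl
      by_cases hg : ∃ q : Q.Δ ν →ₗ[A] Q.nabla ν, q ∘ₗ p ∘ₗ φ ≠ 0
      · obtain ⟨q, hq⟩ := hg
        let e := LinearEquiv.ofBijective (p ∘ₗ φ) (bijective_of_comp_ne_zero _ q hq)
        have he : ∀ z, p (φ (e.symm z)) = z := e.apply_symm_apply
        have he' : ∀ z, e.symm (p (φ z)) = z := e.symm_apply_apply
        obtain ⟨π, hπ⟩ := hs.exists_factor_left (LinearMap.id - φ ∘ₗ e.symm.toLinearMap ∘ₗ p) (by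
          ext y
          simp [he])
        have hπ' : ∀ y, i (π y) = y - φ (e.symm (p y)) := LinearMap.congr_fun hπ
        refine ⟨n, X, π, n.lt_succ_self, hX, ?_, ?_, ?_⟩
        · exact fun x y hxy => e.injective (congrArg p hxy)
        · intro y
          rw [← map_eq_zero_iff i hs.inj, hπ', sub_eq_zero]
          constructor
          · intro hy
            exact ⟨_, hy.symm⟩
          · rintro ⟨z, rfl⟩
            rw [he']
        · intro x
          refine ⟨i x, hs.inj ?_⟩
          rw [hπ', hs.exact.apply_apply_eq_zero, map_zero, map_zero, sub_zero]
      · push Not at hg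
        obtain ⟨s, hsec⟩ := hs.exists_lift (hX.subsingleton_ext_Δ hl) LinearMap.id
        have hsec' : ∀ z, p (s z) = z := LinearMap.congr_fun hsec
        obtain ⟨r, hr⟩ := hs.exists_factor_left (LinearMap.id - s ∘ₗ p) (by
          ext y
          simp [hsec'])
        have hr' : ∀ y, i (r y) = y - s (p y) := LinearMap.congr_fun hr
        obtain ⟨m, Y, π, hm, hY, hπ⟩ := ih (r ∘ₗ φ) (ψ ∘ₗ i) (by
          intro h0
          apply h
          ext z
          have h1 : ψ (i (r (φ z))) = 0 := LinearMap.congr_fun h0 z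
          have h2 : ψ (s (p (φ z))) = 0 := LinearMap.congr_fun (hg (ψ ∘ₗ s)) z
          rw [hr', map_sub, h2, sub_zero] at h1
          exact h1)
        let R := LinearMap.range φ
        have hρ : ∀ z, R.mkQ (φ z) = 0 := fun z => (Submodule.Quotient.mk_eq_zero R).2 ⟨z, rfl⟩
        refine ⟨1 + m, ModuleCat.of A (F ⧸ R), R.mkQ, by omega,
          (WeylFiltered.Δ hν).append hY (i := R.mkQ ∘ₗ s) (p := R.liftQ (π ∘ₗ r) ?_) ⟨?_, ?_, ?_⟩,
          ⟨?_, LinearMap.exact_iff.2 R.ker_mkQ, R.mkQ_surjective⟩⟩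
        · rintro _ ⟨x, rfl⟩
          exact hπ.exact.apply_apply_eq_zero x
        · rw [← LinearMap.ker_eq_bot, LinearMap.ker_eq_bot']
          intro d hd
          obtain ⟨z, hz⟩ := (Submodule.Quotient.mk_eq_zero R).1 hd
          have h1 : r (φ z) = 0 := hs.inj (by rw [hr', hz, hsec', sub_self, map_zero])
          have h2 : z = 0 := hπ.inj (h1.trans (map_zero _).symm)
          rw [← hsec' d, ← hz, h2, map_zero, map_zero]
        · intro y
          obtain ⟨y, rfl⟩ := R.mkQ_surjective y
          constructor
          · intro hy
            obtain ⟨z, hz⟩ := (hπ.exact (r y)).1 hy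
            have h1 : φ z - s (p (φ z)) = y - s (p y) := by
              rw [← hr', ← hr', ← hz]
              rfl
            refine ⟨p y - p (φ z), ?_⟩
            have h2 : s (p y - p (φ z)) = y - φ z := by
              rw [map_sub]
              generalize s (p (φ z)) = a at h1 ⊢
              rw [sub_eq_iff_eq_add.1 h1]
              abel
            change R.mkQ (s (p y - p (φ z))) = _
            rw [h2, map_sub, hρ, sub_zero]
          · rintro ⟨d, hd⟩
            rw [← hd]
            have h1 : r (s d) = 0 := hs.inj (by rw [hr', hsec', sub_self, map_zero])
            change π (r (s d)) = 0
            rw [h1, map_zero]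
        · intro y
          obtain ⟨x, rfl⟩ := hπ.surj y
          refine ⟨R.mkQ (i x), ?_⟩
          have h1 : r (i x) = x := hs.inj (by
            rw [hr', hs.exact.apply_apply_eq_zero, map_zero, sub_zero])
          change π (r (i x)) = π x
          rw [h1]
        · exact fun x y hxy => hπ.inj (congrArg r hxy)
    · obtain ⟨φ', rfl⟩ := hs.exists_factor_left φ (Q.hom_Δ_Δ_eq_zero (fun hle =>
        hl ν hν (lt_of_le_of_ne hle (Ne.symm hνl))) _)
      obtain ⟨m, Y, π, hm, hY, hπ⟩ := ih φ' (ψ ∘ₗ i) h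
      obtain ⟨Z, ρ, j, q, hρ, hjq⟩ := hs.exists_quotient hπ
      exact ⟨m + 1, Z, ρ, by omega, .step hν j q hjq hY, hρ⟩

variable (Q) in
/-- The radical of `End (Δ l)` annihilates some nonzero element. -/
theorem exists_annihilated (l : Λ) : ∃ θ : Q.Δ l →ₗ[A] Q.Δ l, θ ≠ 0 ∧
    ∀ g : Q.Δ l →ₗ[A] Q.Δ l, (∀ p : Q.Δ l →ₗ[A] Q.nabla l, p ∘ₗ g = 0) → g ∘ₗ θ = 0 := by
  let := Module.compHom (Q.Δ l) (algebraMap k A)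
  have : IsScalarTower k A (Q.Δ l) := .of_algebraMap_smul fun _ _ => rfl
  have := Q.finΔ l
  have : Module.Finite k (Q.Δ l) := .trans A _
  have : SMulCommClass A k (Q.Δ l) := inferInstance
  have : Module.Finite k (Module.End A (Q.Δ l)) :=
    .of_injective (LinearMap.restrictScalarsₗ k A (Q.Δ l) (Q.Δ l) k)
      (LinearMap.restrictScalars_injective k)
  have : IsArtinianRing (Module.End A (Q.Δ l)) := IsArtinianRing.of_finite k _
  obtain ⟨q, hq⟩ := Q.exists_hom_Δ_nabla_ne_zero l
  have : Nontrivial (Module.End A (Q.Δ l)) := by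
    refine ⟨⟨1, 0, fun h => hq ?_⟩⟩
    ext x
    have h1 : x = 0 := LinearMap.congr_fun h x
    rw [h1, map_zero, map_zero]
  obtain ⟨I, hI⟩ := IsAtomic.exists_atom (Submodule (Module.End A (Q.Δ l)) (Module.End A (Q.Δ l)))
  obtain ⟨θ, hθI, hθ⟩ := I.ne_bot_iff.1 hI.1
  refine ⟨θ, hθ, fun g hg => ?_⟩
  by_contra hne
  have hle : Submodule.span _ {g * θ} ≤ I :=
    Submodule.span_le.2 (Set.singleton_subset_iff.2 (I.smul_mem g hθI))
  have heq := (hI.le_iff.1 hle).resolve_left fun h => hne (Submodule.span_singleton_eq_bot.1 h)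
  rw [← heq] at hθI
  obtain ⟨r, hr⟩ := Submodule.mem_span_singleton.1 hθI
  have hb := bijective_of_comp_ne_zero (1 - r * g) q (by
    intro h
    apply hq
    rw [LinearMap.comp_sub] at h
    have h1 : q ∘ₗ (r * g) = 0 := hg (q ∘ₗ r)
    rw [h1, sub_zero] at h
    exact h)
  apply hθ
  ext x
  apply hb.1
  have h1 : r (g (θ x)) = θ x := LinearMap.congr_fun hr x
  rw [LinearMap.zero_apply, map_zero]
  change θ x - r (g (θ x)) = 0
  rw [h1, sub_self]

theorem WeylFiltered.comp_eq_zero {n : ℕ} {F : ModuleCat.{u} A} (hF : Q.WeylFiltered Γ n F)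
    {l : Λ} (hl : ∀ ν ∈ Γ, ¬ l < ν) {θ : Q.Δ l →ₗ[A] Q.Δ l}
    (hθ : ∀ g : Q.Δ l →ₗ[A] Q.Δ l, (∀ p : Q.Δ l →ₗ[A] Q.nabla l, p ∘ₗ g = 0) → g ∘ₗ θ = 0)
    (β : Q.Δ l →ₗ[A] F) (hβ : ∀ ψ : F →ₗ[A] Q.nabla l, ψ ∘ₗ β = 0) : β ∘ₗ θ = 0 := by
  induction hF with
  | zero M hM => exact LinearMap.ext fun x => Subsingleton.elim _ _
  | @step n X F ν hν i p h hX ih =>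
    by_cases hνl : ν = l
    · subst hνl
      obtain ⟨s, hs⟩ := h.exists_lift (hX.subsingleton_ext_Δ hl) LinearMap.id
      have hs' : ∀ z, p (s z) = z := LinearMap.congr_fun hs
      obtain ⟨r, hr⟩ := h.exists_factor_left (LinearMap.id - s ∘ₗ p) (by
        ext y
        simp [hs'])
      have hr' : ∀ y, i (r y) = y - s (p y) := LinearMap.congr_fun hr
      have h1 := hθ (p ∘ₗ β) fun q => hβ (q ∘ₗ p)
      have h2 := ih (r ∘ₗ β) fun ψ => hβ (ψ ∘ₗ r)
      ext x
      have h1' : p (β (θ x)) = 0 := LinearMap.congr_fun h1 x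
      have h2' : r (β (θ x)) = 0 := LinearMap.congr_fun h2 x
      have h3 := hr' (β (θ x))
      rw [h1', h2', map_zero, map_zero, sub_zero] at h3
      exact h3.symm
    · obtain ⟨β', rfl⟩ := h.exists_factor_left β (Q.hom_Δ_Δ_eq_zero (fun hle =>
        hl ν hν (lt_of_le_of_ne hle (Ne.symm hνl))) _)
      rw [LinearMap.comp_assoc, ih β', LinearMap.comp_zero]
      intro ψ
      obtain ⟨ψ', rfl⟩ := h.exists_extend (Q.subsingleton_ext_Δ_nabla 0 ν l) ψ
      exact hβ ψ'

theorem WeylFiltered.hom_Δ_eq_zero {n : ℕ} {F : ModuleCat.{u} A} (hF : Q.WeylFiltered Γ n F)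
    {l : Λ} (hl : ∀ ν ∈ Γ, ¬ l < ν) (h0 : ∀ ψ : F →ₗ[A] Q.nabla l, ψ = 0)
    (f : Q.Δ l →ₗ[A] F) : f = 0 := by
  induction hF with
  | zero M hM => exact LinearMap.ext fun x => Subsingleton.elim _ _
  | @step n X F ν hν i p h hX ih =>
    have hνl : ν ≠ l := by
      rintro rfl
      obtain ⟨q, hq⟩ := Q.exists_hom_Δ_nabla_ne_zero ν
      apply hq
      ext y
      obtain ⟨x, rfl⟩ := h.surj y
      exact LinearMap.congr_fun (h0 (q ∘ₗ p)) x
    obtain ⟨f', rfl⟩ := h.exists_factor_left f (Q.hom_Δ_Δ_eq_zero (fun hle =>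
      hl ν hν (lt_of_le_of_ne hle (Ne.symm hνl))) _)
    rw [ih _ f', LinearMap.comp_zero]
    intro ψ
    obtain ⟨ψ', rfl⟩ := h.exists_extend (Q.subsingleton_ext_Δ_nabla 0 ν l) ψ
    rw [h0 ψ', LinearMap.zero_comp]

/-- Maps from `F` to `∇ l`, `l` maximal in `Γ`, vanish on the kernel of `c`. -/
def IsMinimalCover (Q : QuasiHereditaryData k A Λ) (Γ : Set Λ) {F M : ModuleCat.{u} A}
    (c : F →ₗ[A] M) : Prop :=
  ∀ l ∈ Γ, (∀ ν ∈ Γ, ¬ l < ν) → ∀ ψ : F →ₗ[A] Q.nabla l, ψ ∘ₗ (LinearMap.ker c).subtype = 0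

theorem WeylFiltered.exists_isMinimalCover (hΓ : IsLowerSet Γ) {M : ModuleCat.{u} A} (n : ℕ) :
    ∀ {F : ModuleCat.{u} A}, Q.WeylFiltered Γ n F → ∀ c : F →ₗ[A] M, Function.Surjective c →
      ∃ (m : ℕ) (F' : ModuleCat.{u} A) (c' : F' →ₗ[A] M), Q.WeylFiltered Γ m F' ∧
        Function.Surjective c' ∧ Q.IsMinimalCover Γ c' := by
  induction n using Nat.strong_induction_on with
  | _ n ih =>
  intro F hF c hc
  by_cases hmin : Q.IsMinimalCover Γ c
  · exact ⟨n, F, c, hF, hc, hmin⟩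
  simp only [IsMinimalCover, not_forall] at hmin
  obtain ⟨l, hlΓ, hl, ψ, hψ⟩ := hmin
  have : IsNoetherianRing A := IsNoetherianRing.of_finite k A
  have := hF.finite
  have := Q.finNabla l
  let K := ModuleCat.of A (LinearMap.ker c)
  let χ : K →ₗ[A] Q.nabla l := ψ ∘ₗ (LinearMap.ker c).subtype
  let Y := ModuleCat.of A (LinearMap.range χ)
  have : Module.Finite A K := inferInstanceAs (Module.Finite A (LinearMap.ker c))
  have : Module.Finite A Y := inferInstanceAs (Module.Finite A (LinearMap.range χ))
  have hY : ∃ ν, ∃ f : Q.Δ ν →ₗ[A] Y, f ≠ 0 := by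
    by_contra! h
    have := Q.subsingleton_of_hom_Δ_eq_zero Y h
    apply hψ
    ext x
    exact congrArg Subtype.val (Subsingleton.elim (α := Y) (χ.rangeRestrict x) 0)
  obtain ⟨ν, f, hf⟩ := hY
  have hf' : (LinearMap.range χ).subtype ∘ₗ f ≠ 0 := by
    intro h
    apply hf
    ext x
    exact LinearMap.congr_fun h x
  have hν : ν = l := by
    by_contra hν
    exact hf' (Q.hom_Δ_nabla_eq_zero hν _)
  subst hν
  obtain ⟨φ, hφ⟩ := ((hF.supportedOn hΓ).submodule (LinearMap.ker c)).exists_lift hΓ hlΓ hl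
    (Y := Y) χ.rangeRestrict χ.surjective_rangeRestrict f
  obtain ⟨m, F', π, hm, hF', hπ⟩ := hF.exists_quotient hl ((LinearMap.ker c).subtype ∘ₗ φ) ψ (by
    rw [← hφ] at hf'
    exact hf')
  obtain ⟨c', rfl⟩ := hπ.exists_factor_right c (by
    ext x
    exact (φ x).2)
  exact ih m hm hF' c' (Function.Surjective.of_comp hc)

theorem SupportedOn.exists_minimal_cover (hΓ : IsLowerSet Γ) {M : ModuleCat.{u} A}
    (hM : Q.SupportedOn Γ M) [Module.Finite A M] :
    ∃ (n : ℕ) (F : ModuleCat.{u} A) (c : F →ₗ[A] M), Q.WeylFiltered Γ n F ∧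
      Function.Surjective c ∧ Q.IsMinimalCover Γ c := by
  obtain ⟨n, F, c, hF, hc⟩ := hM.exists_cover hΓ
  exact WeylFiltered.exists_isMinimalCover hΓ n hF c hc

theorem WeylFiltered.finite_ker {n : ℕ} {F M : ModuleCat.{u} A} (hF : Q.WeylFiltered Γ n F)
    (c : F →ₗ[A] M) : Module.Finite A (ModuleCat.of A (LinearMap.ker c)) := by
  have : IsNoetherianRing A := IsNoetherianRing.of_finite k A
  have := hF.finite
  exact inferInstanceAs (Module.Finite A (LinearMap.ker c))

theorem SupportedOn.hom_Δ_eq_zero (hΓ : IsLowerSet Γ) {K : ModuleCat.{u} A}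
    (hK : Q.SupportedOn Γ K) [Module.Finite A K] {l : Λ} (hlΓ : l ∈ Γ) (hl : ∀ ν ∈ Γ, ¬ l < ν)
    (h : ∀ ψ : K →ₗ[A] Q.nabla l, ψ = 0) (f : Q.Δ l →ₗ[A] K) : f = 0 := by
  obtain ⟨n, F, c, hF, hc, hmin⟩ := hK.exists_minimal_cover hΓ
  have := hF.finite
  obtain ⟨g, rfl⟩ := (hF.supportedOn hΓ).exists_lift hΓ hlΓ hl c hc f
  rw [hF.hom_Δ_eq_zero hl _ g, LinearMap.comp_zero]
  intro ψ
  obtain ⟨ψ', rfl⟩ := (IsSES.of_surjective hc).exists_factor_right ψ (hmin l hlΓ hl ψ)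
  rw [h ψ', LinearMap.zero_comp]

theorem SupportedOn.subsingleton_ext_one_of_ext_two (hΓ : IsLowerSet Γ) {M : ModuleCat.{u} A}
    (hM : Q.SupportedOn Γ M) [Module.Finite A M] {l : Λ} (hlΓ : l ∈ Γ) (hl : ∀ ν ∈ Γ, ¬ l < ν)
    (h : Subsingleton (Ext.{u} M (Q.nabla l) 2)) : Subsingleton (Ext.{u} M (Q.nabla l) 1) := by
  obtain ⟨n, F, c, hF, hc, hmin⟩ := hM.exists_minimal_cover hΓ
  have hs := IsSES.of_surjective hc
  set K := ModuleCat.of A (LinearMap.ker c)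
  have hK : Q.SupportedOn Γ K := (hF.supportedOn hΓ).submodule _
  have : Module.Finite A K := hF.finite_ker c
  refine hs.subsingleton_ext_right (n := 0) (subsingleton_ext_zero_iff.2 ?_)
    (hF.subsingleton_ext_nabla 0 l)
  by_contra! hψ
  obtain ⟨ψ, hψ⟩ := hψ
  have hext := hs.subsingleton_ext_left (n := 1) h (hF.subsingleton_ext_nabla 0 l)
  obtain ⟨m, G, d, hG, hd, hmin'⟩ := hK.exists_minimal_cover hΓ
  have hs' := IsSES.of_surjective hd
  have : Module.Finite A (ModuleCat.of A (LinearMap.ker d)) := hG.finite_ker d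
  have hW : ∀ f : Q.Δ l →ₗ[A] ModuleCat.of A (LinearMap.ker d), f = 0 := by
    refine ((hG.supportedOn hΓ).submodule _).hom_Δ_eq_zero hΓ hlΓ hl fun χ => ?_
    obtain ⟨χ', rfl⟩ := hs'.exists_extend hext χ
    exact hmin' l hlΓ hl χ'
  obtain ⟨α, hα⟩ := hG.exists_comp_ne_zero hl (fun ν _ hν g => Q.hom_Δ_nabla_eq_zero hν g)
    (ψ ∘ₗ d) (by
      intro h0
      apply hψ
      ext x
      obtain ⟨y, rfl⟩ := hd x
      exact LinearMap.congr_fun h0 y)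
  obtain ⟨_, _, _, _, _, hα'⟩ := hG.exists_quotient hl α (ψ ∘ₗ d) hα
  obtain ⟨θ, hθ, hθ'⟩ := Q.exists_annihilated l
  have hβ := hF.comp_eq_zero hl hθ' ((LinearMap.ker c).subtype ∘ₗ d ∘ₗ α) fun χ => by
    ext x
    exact LinearMap.congr_fun (hmin l hlΓ hl χ) (d (α x))
  obtain ⟨γ, hγ⟩ := hs'.exists_factor_left (α ∘ₗ θ) (by
    ext x
    exact LinearMap.congr_fun hβ x)
  rw [hW γ, LinearMap.comp_zero] at hγ
  apply hθ
  ext x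
  apply hα'.inj
  rw [LinearMap.zero_apply, map_zero]
  exact (LinearMap.congr_fun hγ x).symm

theorem SupportedOn.subsingleton_ext_one (hΓ : IsLowerSet Γ) {l : Λ} (hlΓ : l ∈ Γ)
    (hl : ∀ ν ∈ Γ, ¬ l < ν) (n : ℕ) :
    ∀ {M : ModuleCat.{u} A}, Q.SupportedOn Γ M → Module.Finite A M →
      (∀ j, n < j → Subsingleton (Ext.{u} M (Q.nabla l) j)) →
      Subsingleton (Ext.{u} M (Q.nabla l) 1) := by
  induction n with
  | zero => exact fun _ _ h => h 1 one_pos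
  | succ n ih =>
    intro M hM _ h
    obtain ⟨m, F, c, hF, hc⟩ := hM.exists_cover hΓ
    have hs := IsSES.of_surjective hc
    refine hM.subsingleton_ext_one_of_ext_two hΓ hlΓ hl
      (hs.subsingleton_ext_right (n := 1) ?_ (hF.subsingleton_ext_nabla 1 l))
    refine ih ((hF.supportedOn hΓ).submodule _) (hF.finite_ker c) fun j hj => ?_
    obtain ⟨j, rfl⟩ := Nat.exists_eq_add_one_of_ne_zero (Nat.ne_of_gt (Nat.zero_lt_of_lt hj))
    exact hs.subsingleton_ext_left (h _ (by omega)) (hF.subsingleton_ext_nabla j l)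

/-- If `Ext^i(M, ∇ ν) ≠ 0` and the Weyl filtration dimension of `M` is finite, then the support
of `M` contains a chain of length `i`. -/
theorem SupportedOn.exists_strictMono (i : ℕ) :
    ∀ {Γ : Set Λ} {M : ModuleCat.{u} A} (n : ℕ), IsLowerSet Γ → Q.SupportedOn Γ M →
      Module.Finite A M → (∀ j, n < j → ∀ ν, Subsingleton (Ext.{u} M (Q.nabla ν) j)) →
      (∃ ν, ¬ Subsingleton (Ext.{u} M (Q.nabla ν) i)) →
      ∃ c : Fin (i + 1) → Λ, StrictMono c ∧ ∀ j, c j ∈ Γ := by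
  induction i with
  | zero =>
    rintro Γ M n - hM _ - ⟨ν, hν⟩
    have hne : Γ.Nonempty := by
      by_contra hΓ
      rw [Set.not_nonempty_iff_eq_empty] at hΓ
      subst hΓ
      have := Q.subsingleton_of_hom_Δ_eq_zero M fun ν f => hM ν (Set.notMem_empty ν) f
      exact hν (subsingleton_ext_zero_iff.2 fun f => LinearMap.ext fun x => by
        rw [Subsingleton.elim x 0, map_zero, map_zero])
    obtain ⟨μ, hμ⟩ := hne
    exact ⟨fun _ => μ, fun a b hab => by omega, fun _ => hμ⟩
  | succ i ih =>
    rintro Γ M n hΓ hM _ hn ⟨ν, hν⟩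
    obtain ⟨m, F, c, hF, hc, hmin⟩ := hM.exists_minimal_cover hΓ
    have hs := IsSES.of_surjective hc
    have hKΓ : Q.SupportedOn Γ (ModuleCat.of A (LinearMap.ker c)) :=
      (hF.supportedOn hΓ).submodule _
    have : Module.Finite A (ModuleCat.of A (LinearMap.ker c)) := hF.finite_ker c
    have hK : Q.SupportedOn {μ | ∃ κ ∈ Γ, μ < κ} (ModuleCat.of A (LinearMap.ker c)) := by
      intro μ hμ f
      by_cases hμΓ : μ ∈ Γ
      · have hmax : ∀ κ ∈ Γ, ¬ μ < κ := fun κ hκ h => hμ ⟨κ, hκ, h⟩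
        refine hKΓ.hom_Δ_eq_zero hΓ hμΓ hmax (fun ψ => ?_) f
        obtain ⟨ψ', rfl⟩ := hs.exists_extend
          (hM.subsingleton_ext_one hΓ hμΓ hmax n ‹_› fun j hj => hn j hj μ) ψ
        exact hmin μ hμΓ hmax ψ'
      · exact hKΓ μ hμΓ f
    obtain ⟨b, hb, hbΓ⟩ := ih (Γ := {μ | ∃ κ ∈ Γ, μ < κ}) (n + 1)
      (fun μ μ' h ⟨κ, hκ, h'⟩ => ⟨κ, hκ, h.trans_lt h'⟩) hK this
      (fun j hj μ => by
        obtain ⟨j, rfl⟩ := Nat.exists_eq_add_one_of_ne_zero (Nat.ne_of_gt (Nat.zero_lt_of_lt hj))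
        exact hs.subsingleton_ext_left (hn _ (by omega) μ) (hF.subsingleton_ext_nabla j μ))
      ⟨ν, fun h => hν (hs.subsingleton_ext_right h (hF.subsingleton_ext_nabla i ν))⟩
    obtain ⟨κ, hκ, hlt⟩ := hbΓ (Fin.last i)
    refine ⟨Fin.snoc b κ, ?_, fun j => ?_⟩
    · rw [Fin.strictMono_iff_lt_succ]
      intro j
      induction j using Fin.lastCases with
      | last =>
        rw [Fin.snoc_castSucc, Fin.succ_last, Fin.snoc_last]
        exact hlt
      | cast j =>
        rw [Fin.snoc_castSucc, ← Fin.castSucc_succ, Fin.snoc_castSucc]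
        exact hb Fin.castSucc_lt_succ
    · induction j using Fin.lastCases with
      | last => rwa [Fin.snoc_last]
      | cast j =>
        rw [Fin.snoc_castSucc]
        obtain ⟨κ', hκ', hlt'⟩ := hbΓ j
        exact hΓ hlt'.le hκ'

end QuasiHereditaryData

theorem le_chainLength {d : ℕ} {l : Λ} {c : Fin (d + 1) → Λ} (hc : StrictMono c)
    (hl : c (Fin.last d) = l) : d ≤ chainLength l := by
  refine le_csSup ⟨Fintype.card Λ, ?_⟩ ⟨c, hc, hl⟩
  rintro e ⟨b, hb, -⟩
  have := Fintype.card_le_of_injective b hb.injective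
  rw [Fintype.card_fin] at this
  omega

theorem le_chainLength_of_forall_le {d : ℕ} {l : Λ} {c : Fin (d + 1) → Λ} (hc : StrictMono c)
    (hl : ∀ j, c j ≤ l) : d ≤ chainLength l := by
  refine le_chainLength (c := Function.update c (Fin.last d) l) ?_ (Function.update_self ..)
  intro i j hij
  rw [Function.update_of_ne (ne_of_lt (hij.trans_le (Fin.le_last j)))]
  by_cases hj : j = Fin.last d
  · subst hj
    rw [Function.update_self]
    exact (hc hij).trans_le (hl _)
  · rw [Function.update_of_ne hj]
    exact hc hij

/-- Let `A` be a finite-dimensional quasi-hereditary algebra with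
weight poset `(Λ,≤)`. For every `λ ∈ Λ`, the Weyl filtration dimension of the
costandard module satisfies `wfd(∇(λ)) ≤ l(λ)`, where `l(λ)` is the maximal length
`l` of a chain `μ₀ < μ₁ < ⋯ < μ_{l−1} < μ_l = λ` of elements of `Λ`. -/
theorem wfd_nabla_le_chainLength
    (Q : QuasiHereditaryData k A Λ) (l : Λ) :
    Q.wfd (Q.nabla l) ≤ chainLength l := by
  by_cases hb : BddAbove {d | ∃ m, ¬ IsZero (extA k A d (Q.nabla l) (Q.nabla m))}
  · refine csSup_le' ?_
    rintro d ⟨m, hm⟩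
    obtain ⟨n, hn⟩ := hb
    match d, hm with
    | 0, _ => exact Nat.zero_le _
    | d + 1, hm =>
      have hsupp : Q.SupportedOn (Set.Iic l) (Q.nabla l) := .nabla (Set.mem_Iic.2 le_rfl)
      obtain ⟨c, hc, hcl⟩ := hsupp.exists_strictMono (d + 1) n (isLowerSet_Iic l) (Q.finNabla l)
        (fun j hj ν => by
          obtain ⟨j, rfl⟩ := Nat.exists_eq_add_one_of_ne_zero
            (Nat.ne_of_gt (Nat.zero_lt_of_lt hj))
          rw [← isZero_extA_succ_iff (k := k)]
          by_contra h
          exact absurd (hn ⟨ν, h⟩) (not_le.2 hj))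
        ⟨m, mt (isZero_extA_succ_iff d _ _).2 hm⟩
      exact le_chainLength_of_forall_le hc hcl
  · rw [QuasiHereditaryData.wfd, Nat.sSup_of_not_bddAbove hb]
    exact Nat.zero_le _
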